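/- arXiv:0910.2082 — 2 statements merged into one kernel-verified Lean document; each statement's English description precedes it below -/
import Mathlib

section
/- Let ζ_1,…,ζ_5 be n×n complex matrices with all pairwise differences invertible. Then: (i) the n-fold Berezin integral ∫⋯∫ f_{1234} f_{1235} 𝒟a_{123} equals the generating function with inner column set ℐ (ℐ = the n columns of face 123) of the 4n×7n matrix obtained by vertically concatenating the 2n×4n matrices f_3^{full} of the tetrahedra 1234 and 1235, each extended by zero block columns to the full list of faces 123, 124, 125, 134, 135, 234, 235; (ii) the 3n-fold integral ∫⋯∫ f_{1245} f_{2345} f_{1345} 𝒟a_{145} 𝒟a_{245} 𝒟a_{345} equals the generating function with inner column set ℐ′ (ℐ′ = the 3n columns of faces 145, 245, 345) of the 6n×9n matrix obtained by vertically concatenating the zero-extended matrices f_3^{full} of the tetrahedra 1245, 2345, 1345 over the faces 124, 125, 134, 135, 234, 235, 145, 245, 345. -/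
/-!
A concrete model of the Grassmann algebra over `ℂ` with generators indexed by a
linearly ordered type `ι`.
-/

namespace Grassmann

variable {ι : Type} [LinearOrder ι]

/-- An element of the Grassmann algebra, as the coefficient function on basis monomials. -/
abbrev G (ι : Type) : Type := Finset ι → ℂ

/-- The product in the Grassmann algebra (shuffle product with signs). -/
noncomputable def gmul (f g : G ι) : G ι := fun U =>
  ∑ S ∈ U.powerset,
    ((-1 : ℂ) ^ (((S ×ˢ (U \ S)).filter fun p => p.2 < p.1).card)) * f S * g (U \ S)

/-- The unit of the Grassmann algebra. -/
def gone : G ι := fun S => if S = ∅ then 1 else 0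

/-- The generator `a_i` of the Grassmann algebra. -/
def gen (i : ι) : G ι := fun S => if S = {i} then 1 else 0

/-- The ordered product `a_{l₁} a_{l₂} ⋯ a_{l_k}` of the generators listed in `l`. -/
noncomputable def genProdL : List ι → G ι :=
  fun l => l.foldr (fun i acc => gmul (gen i) acc) gone

/-- The Berezin integral `∫ f da_i` (right derivative in `a_i`). -/
noncomputable def berezin (i : ι) (f : G ι) : G ι := fun T =>
  if i ∈ T then 0 else (-1 : ℂ) ^ ((T.filter fun j => i < j).card) * f (insert i T)

/-- The iterated Berezin integral `∫⋯∫ f da_{l₁} ⋯ da_{l_k}` over the differentials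
listed in `l`, with the convention `∫∫ f(a) g(b) da db = (∫ f da) (∫ g db)`. -/
noncomputable def multiBerezin : List ι → G ι → G ι :=
  fun l f => l.foldr berezin f

end Grassmann

open Grassmann

/-- A `b·n × c·n` matrix assembled from `n × n` blocks. -/
def ofBlocks {b c n : ℕ} (B : Fin b → Fin c → Matrix (Fin n) (Fin n) ℂ) :
    Matrix (Fin (b * n)) (Fin (c * n)) ℂ :=
  Matrix.of fun i j =>
    B ⟨(i : ℕ) / n, by
        rcases Nat.eq_zero_or_pos n with h | h
        · exact absurd i.isLt (by simp [h])
        · exact (Nat.div_lt_iff_lt_mul h).2 i.isLt⟩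
      ⟨(j : ℕ) / n, by
        rcases Nat.eq_zero_or_pos n with h | h
        · exact absurd j.isLt (by simp [h])
        · exact (Nat.div_lt_iff_lt_mul h).2 j.isLt⟩
      ⟨(i : ℕ) % n, Nat.mod_lt _ (by
        rcases Nat.eq_zero_or_pos n with h | h
        · exact absurd i.isLt (by simp [h])
        · exact h)⟩
      ⟨(j : ℕ) % n, Nat.mod_lt _ (by
        rcases Nat.eq_zero_or_pos n with h | h
        · exact absurd j.isLt (by simp [h])
        · exact h)⟩

/-- The index type for the `10 n` Grassmann generators: the component `c` of the vector
`a_{ijk}` of `n` generators attached to the face `{i,j,k} ⊂ {1,…,5}`, `i < j < k`;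
ordered by the face (lexicographically) first, then by the component. -/
abbrev FaceComp (n : ℕ) : Type := (Fin 5 ×ₗ Fin 5 ×ₗ Fin 5) ×ₗ Fin n

/-- The generator index of component `c` of the generator vector `a_{ijk}`. -/
def fc {n : ℕ} (i j k : Fin 5) (c : Fin n) : FaceComp n :=
  toLex (toLex (i, toLex (j, k)), c)

/-- The list of the `n` generator indices of `a_{ijk}` in their natural order:
the differential `𝒟a_{ijk}`. -/
def Da (n : ℕ) (i j k : Fin 5) : List (FaceComp n) :=
  (List.finRange n).map (fc i j k)

/-- The determinant of the maximal square submatrix of `A` on the columns listed in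
`cols` (in the listed order). -/
noncomputable def detColumns {r m : ℕ} (A : Matrix (Fin r) (Fin m) ℂ)
    (cols : List (Fin m)) : ℂ :=
  (Matrix.of fun i j : Fin r =>
    if hj : (j : ℕ) < cols.length then A i (cols.get ⟨j, hj⟩) else 0).det

/-- The generating function `𝐟_A := Σ_𝒞 det (A|_𝒞) Π_{k ∈ 𝒞} a_{col k}` of an `r × m`
complex matrix `A` whose column `k` carries the Grassmann generator `a_{col k}`; the sum
is over all `r`-element subsets `𝒞` of the set of columns and the generators are
multiplied in the order of the columns. -/
noncomputable def genFunL {ι : Type} [LinearOrder ι] {r m : ℕ}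
    (A : Matrix (Fin r) (Fin m) ℂ) (col : Fin m → ι) : G ι :=
  ∑ C : Finset (Fin m),
    (if C.card = r then detColumns A (C.sort (· ≤ ·)) else 0) •
      genProdL ((C.sort (· ≤ ·)).map col)

/-- The `2 × 4` block structure (`n × n` blocks) of the matrix `f₃^full` of one
tetrahedron `i₁i₂i₃i₄` (`i₁ < i₂ < i₃ < i₄`), formula (19) of the paper:
`[[1, −1, 1, 0], [ζ_{i₂i₃}⁻¹ ζ_{i₃i₁}, −ζ_{i₂i₄}⁻¹ ζ_{i₄i₁}, 0, −1]]`. -/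
noncomputable def tetraBlocks {n : ℕ} (ζ : Fin 5 → Matrix (Fin n) (Fin n) ℂ)
    (i₁ i₂ i₃ i₄ : Fin 5) : Fin 2 → Fin 4 → Matrix (Fin n) (Fin n) ℂ :=
  ![![1, -1, 1, 0],
    ![(ζ i₂ - ζ i₃)⁻¹ * (ζ i₃ - ζ i₁), -((ζ i₂ - ζ i₄)⁻¹ * (ζ i₄ - ζ i₁)), 0, -1]]

/-- The four faces of the tetrahedron `i₁i₂i₃i₄`, in the order of the block columns
of `f₃^full`. -/
def tetraFaces (i₁ i₂ i₃ i₄ : Fin 5) : Fin 4 → Fin 5 × Fin 5 × Fin 5 :=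
  ![(i₁, i₂, i₃), (i₁, i₂, i₄), (i₁, i₃, i₄), (i₂, i₃, i₄)]

/-- The generator carried by column `j` of the `2n × 4n` matrix `f₃^full` of the
tetrahedron `i₁i₂i₃i₄`: component `j mod n` of the generator vector of face `j / n`. -/
def tetraCol {n : ℕ} (i₁ i₂ i₃ i₄ : Fin 5) (j : Fin (4 * n)) : FaceComp n :=
  fc (tetraFaces i₁ i₂ i₃ i₄ ⟨(j : ℕ) / n, by
        rcases Nat.eq_zero_or_pos n with h | h
        · exact absurd j.isLt (by simp [h])
        · exact (Nat.div_lt_iff_lt_mul h).2 j.isLt⟩).1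
    (tetraFaces i₁ i₂ i₃ i₄ ⟨(j : ℕ) / n, by
        rcases Nat.eq_zero_or_pos n with h | h
        · exact absurd j.isLt (by simp [h])
        · exact (Nat.div_lt_iff_lt_mul h).2 j.isLt⟩).2.1
    (tetraFaces i₁ i₂ i₃ i₄ ⟨(j : ℕ) / n, by
        rcases Nat.eq_zero_or_pos n with h | h
        · exact absurd j.isLt (by simp [h])
        · exact (Nat.div_lt_iff_lt_mul h).2 j.isLt⟩).2.2
    ⟨(j : ℕ) % n, Nat.mod_lt _ (by
        rcases Nat.eq_zero_or_pos n with h | h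
        · exact absurd j.isLt (by simp [h])
        · exact h)⟩

/-- The weight `𝐟_{i₁i₂i₃i₄}` of a tetrahedron with matrix coordinates: the generating
function of the `2n × 4n` matrix `f₃^full`, whose four block columns carry the generator
vectors `a_{i₁i₂i₃}`, `a_{i₁i₂i₄}`, `a_{i₁i₃i₄}`, `a_{i₂i₃i₄}`. -/
noncomputable def tetraWeight {n : ℕ} (ζ : Fin 5 → Matrix (Fin n) (Fin n) ℂ)
    (i₁ i₂ i₃ i₄ : Fin 5) : G (FaceComp n) :=
  genFunL (ofBlocks (tetraBlocks ζ i₁ i₂ i₃ i₄)) (tetraCol i₁ i₂ i₃ i₄)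

/-- The `4 × 7` block structure of the matrix `(f₃^full)` for the left-hand side of the
Pachner move 2→3 (the two tetrahedra `1234`, `1235`, here with vertices `0,…,4 : Fin 5`):
block rows correspond to `dψ_{1,1234}`, `dψ_{2,1234}`, `dψ_{1,1235}`, `dψ_{2,1235}`, block
columns to the faces `123, 124, 125, 134, 135, 234, 235`; formula (21) of the paper. -/
noncomputable def LBlocks {n : ℕ} (ζ : Fin 5 → Matrix (Fin n) (Fin n) ℂ) :
    Fin 4 → Fin 7 → Matrix (Fin n) (Fin n) ℂ :=
  ![![1, -1, 0, 1, 0, 0, 0],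
    ![(ζ 1 - ζ 2)⁻¹ * (ζ 2 - ζ 0), -((ζ 1 - ζ 3)⁻¹ * (ζ 3 - ζ 0)), 0, 0, 0, -1, 0],
    ![1, 0, -1, 0, 1, 0, 0],
    ![(ζ 1 - ζ 2)⁻¹ * (ζ 2 - ζ 0), 0, -((ζ 1 - ζ 4)⁻¹ * (ζ 4 - ζ 0)), 0, 0, 0, -1]]

/-- The face carried by each of the `7` block columns of the matrix `L`. -/
def LFaces : Fin 7 → Fin 5 × Fin 5 × Fin 5 :=
  ![(0, 1, 2), (0, 1, 3), (0, 1, 4), (0, 2, 3), (0, 2, 4), (1, 2, 3), (1, 2, 4)]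

/-- The `6 × 9` block structure of the matrix `(f₃^full)` for the right-hand side of the
Pachner move 2→3 (the three tetrahedra `1245`, `2345`, `1345`): block rows correspond to
`dψ_{1,1245}`, `dψ_{2,1245}`, `dψ_{2,2345}`, `dψ_{3,2345}`, `dψ_{1,1345}`, `dψ_{3,1345}`,
block columns to the faces `124, 125, 134, 135, 234, 235, 145, 245, 345`. -/
noncomputable def RBlocks {n : ℕ} (ζ : Fin 5 → Matrix (Fin n) (Fin n) ℂ) :
    Fin 6 → Fin 9 → Matrix (Fin n) (Fin n) ℂ :=
  ![![1, -1, 0, 0, 0, 0, 1, 0, 0],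
    ![(ζ 1 - ζ 3)⁻¹ * (ζ 3 - ζ 0), -((ζ 1 - ζ 4)⁻¹ * (ζ 4 - ζ 0)), 0, 0, 0, 0, 0, -1, 0],
    ![0, 0, 0, 0, 1, -1, 0, 1, 0],
    ![0, 0, 0, 0, (ζ 2 - ζ 3)⁻¹ * (ζ 3 - ζ 1), -((ζ 2 - ζ 4)⁻¹ * (ζ 4 - ζ 1)), 0, 0, -1],
    ![0, 0, 1, -1, 0, 0, 1, 0, 0],
    ![0, 0, (ζ 2 - ζ 3)⁻¹ * (ζ 3 - ζ 0), -((ζ 2 - ζ 4)⁻¹ * (ζ 4 - ζ 0)), 0, 0, 0, 0, -1]]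

/-- The face carried by each of the `9` block columns of the matrix `R`. -/
def RFaces : Fin 9 → Fin 5 × Fin 5 × Fin 5 :=
  ![(0, 1, 3), (0, 1, 4), (0, 2, 3), (0, 2, 4), (1, 2, 3), (1, 2, 4),
    (0, 3, 4), (1, 3, 4), (2, 3, 4)]

/-- The matrix `(f₃^full)_{l.h.s.}` of the left-hand side of the Pachner move. -/
noncomputable def Lmat {n : ℕ} (ζ : Fin 5 → Matrix (Fin n) (Fin n) ℂ) :
    Matrix (Fin (4 * n)) (Fin (7 * n)) ℂ :=
  ofBlocks (LBlocks ζ)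

/-- The matrix `(f₃^full)_{r.h.s.}` of the right-hand side of the Pachner move. -/
noncomputable def Rmat {n : ℕ} (ζ : Fin 5 → Matrix (Fin n) (Fin n) ℂ) :
    Matrix (Fin (6 * n)) (Fin (9 * n)) ℂ :=
  ofBlocks (RBlocks ζ)

/-- The set of inner columns of `L`: the `n` columns of the face `123`. -/
def LInner (n : ℕ) : Finset (Fin (7 * n)) :=
  Finset.univ.filter fun j => (j : ℕ) < n

/-- The set of inner columns of `R`: the `3n` columns of the faces `145, 245, 345`. -/
def RInner (n : ℕ) : Finset (Fin (9 * n)) :=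
  Finset.univ.filter fun j => 6 * n ≤ (j : ℕ)

/-- The generator carried by block column `d`, component `e`, given the face labels of
the block columns. -/
def colGen {n m : ℕ} (faces : Fin m → Fin 5 × Fin 5 × Fin 5) (j : Fin (m * n)) :
    FaceComp n :=
  fc (faces ⟨(j : ℕ) / n, by
        rcases Nat.eq_zero_or_pos n with h | h
        · exact absurd j.isLt (by simp [h])
        · exact (Nat.div_lt_iff_lt_mul h).2 j.isLt⟩).1
    (faces ⟨(j : ℕ) / n, by
        rcases Nat.eq_zero_or_pos n with h | h
        · exact absurd j.isLt (by simp [h])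
        · exact (Nat.div_lt_iff_lt_mul h).2 j.isLt⟩).2.1
    (faces ⟨(j : ℕ) / n, by
        rcases Nat.eq_zero_or_pos n with h | h
        · exact absurd j.isLt (by simp [h])
        · exact (Nat.div_lt_iff_lt_mul h).2 j.isLt⟩).2.2
    ⟨(j : ℕ) % n, Nat.mod_lt _ (by
        rcases Nat.eq_zero_or_pos n with h | h
        · exact absurd j.isLt (by simp [h])
        · exact h)⟩

/-- The generating function of a matrix `A` with the set `ℐ` of inner columns
(column `k` carrying the generator `a_{col k}`):
`Σ_{𝒞 ⊇ ℐ} det′ (A|_𝒞) Π_{k ∈ 𝒞 ∖ ℐ} a_{col k}`, where `det′` is the determinant of the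
square submatrix on the columns `𝒞` after moving all the inner columns to the right
(keeping the relative order within `ℐ` and within its complement), and the generators are
multiplied in the order of the columns `𝒞 ∖ ℐ`. -/
noncomputable def genFunInnerL {ι : Type} [LinearOrder ι] {r m : ℕ}
    (A : Matrix (Fin r) (Fin m) ℂ) (col : Fin m → ι) (I : Finset (Fin m)) : G ι :=
  ∑ C : Finset (Fin m),
    (if I ⊆ C ∧ C.card = r then
        detColumns A ((C \ I).sort (· ≤ ·) ++ I.sort (· ≤ ·)) else 0) •
      genProdL (((C \ I).sort (· ≤ ·)).map col)

namespace Grassmann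

variable {ι : Type} [LinearOrder ι]

/-- The sign of the shuffle moving the elements of `S` in front of those of `T`. -/
def shuffleSign (S T : Finset ι) : ℂ :=
  (-1) ^ ((S ×ˢ T).filter fun p => p.2 < p.1).card

lemma shuffleSign_union_left {S T : Finset ι} (R : Finset ι) (h : Disjoint S T) :
    shuffleSign (S ∪ T) R = shuffleSign S R * shuffleSign T R := by
  unfold shuffleSign
  rw [Finset.union_product, Finset.filter_union, Finset.card_union_of_disjoint, pow_add]
  exact Finset.disjoint_filter_filter (Finset.disjoint_product.2 (Or.inl h))

lemma shuffleSign_union_right {S T : Finset ι} (R : Finset ι) (h : Disjoint S T) :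
    shuffleSign R (S ∪ T) = shuffleSign R S * shuffleSign R T := by
  unfold shuffleSign
  rw [Finset.product_union, Finset.filter_union, Finset.card_union_of_disjoint, pow_add]
  exact Finset.disjoint_filter_filter (Finset.disjoint_product.2 (Or.inr h))

lemma gmul_apply (f g : G ι) (U : Finset ι) :
    gmul f g U = ∑ S ∈ U.powerset, shuffleSign S (U \ S) * f S * g (U \ S) := rfl

lemma gmul_assoc (f g h : G ι) : gmul (gmul f g) h = gmul f (gmul g h) := by
  funext U
  simp only [gmul_apply, Finset.mul_sum, Finset.sum_mul]
  rw [Finset.sum_sigma', Finset.sum_sigma']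
  refine Finset.sum_bij' (fun p _ => ⟨p.2, p.1 \ p.2⟩) (fun p _ => ⟨p.1 ∪ p.2, p.1⟩) ?_ ?_ ?_ ?_ ?_
  · rintro ⟨S, T⟩ hp
    simp only [Finset.mem_sigma, Finset.mem_powerset] at hp ⊢
    exact ⟨hp.2.trans hp.1, Finset.sdiff_subset_sdiff hp.1 le_rfl⟩
  · rintro ⟨T, R⟩ hp
    simp only [Finset.mem_sigma, Finset.mem_powerset] at hp ⊢
    exact ⟨Finset.union_subset hp.1 (hp.2.trans Finset.sdiff_subset), Finset.subset_union_left⟩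
  · rintro ⟨S, T⟩ hp
    simp only [Finset.mem_sigma, Finset.mem_powerset] at hp
    simp [Finset.union_sdiff_of_subset hp.2]
  · rintro ⟨T, R⟩ hp
    simp only [Finset.mem_sigma, Finset.mem_powerset] at hp
    have : Disjoint T R := (Finset.disjoint_sdiff).mono_right hp.2
    simp [Finset.union_sdiff_cancel_left this]
  · rintro ⟨S, T⟩ hp
    simp only [Finset.mem_sigma, Finset.mem_powerset] at hp
    obtain ⟨hS, hT⟩ := hp
    have e1 : (U \ T) \ (S \ T) = U \ S := by
      ext x; have := @hT x; simp only [Finset.mem_sdiff]; tauto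
    have e2 : U \ T = (S \ T) ∪ (U \ S) := by
      ext x; have := @hT x; have := @hS x
      simp only [Finset.mem_sdiff, Finset.mem_union]; tauto
    have d1 : Disjoint (S \ T) (U \ S) :=
      (Finset.disjoint_sdiff (s := S) (t := U)).mono_left Finset.sdiff_subset
    have hs : shuffleSign S (U \ S) = shuffleSign T (U \ S) * shuffleSign (S \ T) (U \ S) := by
      rw [← shuffleSign_union_left _ Finset.disjoint_sdiff, Finset.union_sdiff_of_subset hT]
    simp only [e1]
    rw [hs, e2, shuffleSign_union_right _ d1]
    ring

lemma gone_gmul (f : G ι) : gmul gone f = f := by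
  funext U
  rw [gmul_apply, Finset.sum_eq_single ∅]
  · simp [gone, shuffleSign]
  · intro S _ hS
    simp [gone, hS]
  · simp

lemma gmul_gone (f : G ι) : gmul f gone = f := by
  funext U
  rw [gmul_apply, Finset.sum_eq_single U]
  · simp [gone, shuffleSign]
  · intro S hS hne
    have : ¬ U ⊆ S := fun h => hne (Finset.Subset.antisymm (Finset.mem_powerset.1 hS) h)
    simp [gone, Finset.sdiff_eq_empty_iff_subset, this]
  · simp

lemma add_gmul (f g h : G ι) : gmul (f + g) h = gmul f h + gmul g h := by
  funext U
  simp only [gmul_apply, Pi.add_apply, mul_add, add_mul, Finset.sum_add_distrib]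

lemma gmul_add (f g h : G ι) : gmul f (g + h) = gmul f g + gmul f h := by
  funext U
  simp only [gmul_apply, Pi.add_apply, mul_add, Finset.sum_add_distrib]

lemma smul_gmul (c : ℂ) (f g : G ι) : gmul (c • f) g = c • gmul f g := by
  funext U
  simp only [gmul_apply, Pi.smul_apply, smul_eq_mul, Finset.mul_sum]
  exact Finset.sum_congr rfl fun _ _ => by ring

lemma gmul_smul (c : ℂ) (f g : G ι) : gmul f (c • g) = c • gmul f g := by
  funext U
  simp only [gmul_apply, Pi.smul_apply, smul_eq_mul, Finset.mul_sum]
  exact Finset.sum_congr rfl fun _ _ => by ring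

/-- The Grassmann algebra `G ι` as a type carrying its ring structure. -/
def Alg (ι : Type) : Type := G ι

noncomputable instance : AddCommGroup (Alg ι) := inferInstanceAs (AddCommGroup (Finset ι → ℂ))

noncomputable instance : Module ℂ (Alg ι) := inferInstanceAs (Module ℂ (Finset ι → ℂ))

noncomputable instance : Ring (Alg ι) :=
  { (inferInstance : AddCommGroup (Alg ι)) with
    mul := fun f g => gmul f g
    one := (gone : G ι)
    mul_assoc := gmul_assoc
    one_mul := gone_gmul
    mul_one := gmul_gone
    zero_mul := fun f => by
      have h := smul_gmul 0 (0 : G ι) f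
      rw [zero_smul, zero_smul] at h
      exact h
    mul_zero := fun f => by
      have h := gmul_smul 0 f (0 : G ι)
      rw [zero_smul, zero_smul] at h
      exact h
    left_distrib := gmul_add
    right_distrib := add_gmul }

noncomputable instance : Algebra ℂ (Alg ι) := Algebra.ofModule smul_gmul gmul_smul

/-- The generator `a_i`, as an element of the ring `Alg ι`. -/
def agen (i : ι) : Alg ι := gen i

lemma genProdL_eq_prod (l : List ι) : genProdL l = ((l.map agen).prod : Alg ι) := by
  induction l with
  | nil => rfl
  | cons i l ih =>
    rw [List.map_cons, List.prod_cons, ← ih]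
    rfl

lemma gen_gmul_apply (i : ι) (g : G ι) (U : Finset ι) :
    gmul (gen i) g U =
      if i ∈ U then (-1) ^ (U.filter (· < i)).card * g (U.erase i) else 0 := by
  rw [gmul_apply]
  split_ifs with h
  · rw [Finset.sum_eq_single {i}]
    · have : ((({i} : Finset ι) ×ˢ (U \ {i})).filter fun p => p.2 < p.1).card
          = (U.filter (· < i)).card := by
        rw [Finset.singleton_product, Finset.filter_map, Finset.card_map]
        congr 1
        ext x
        simp only [Finset.mem_filter, Finset.mem_sdiff, Finset.mem_singleton, Function.comp,
          Function.Embedding.coeFn_mk]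
        exact ⟨fun h => ⟨h.1.1, h.2⟩, fun h => ⟨⟨h.1, h.2.ne⟩, h.2⟩⟩
      rw [shuffleSign, this]
      simp [gen, Finset.sdiff_singleton_eq_erase]
    · intro S _ hS
      simp [gen, hS]
    · simp [h]
  · refine Finset.sum_eq_zero fun S hS => ?_
    have : S ≠ {i} := by
      rintro rfl
      exact h (by simpa using hS)
    simp [gen, this]

lemma agen_mul_agen (i j : ι) : agen i * agen j = -(agen j * agen i) := by
  funext U
  change gmul (gen i) (gen j) U = -gmul (gen j) (gen i) U
  rw [gen_gmul_apply, gen_gmul_apply]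
  simp only [gen]
  rcases eq_or_ne i j with rfl | hij
  · have : U.erase i ≠ {i} := fun h => by
      have := Finset.notMem_erase i U
      simp [h] at this
    simp [this]
  · by_cases hU : U = {i, j}
    · subst hU
      have e1 : ({i, j} : Finset ι).erase i = {j} := by
        ext x; simp only [Finset.mem_erase, Finset.mem_insert, Finset.mem_singleton]; grind
      have e2 : ({i, j} : Finset ι).erase j = {i} := by
        ext x; simp only [Finset.mem_erase, Finset.mem_insert, Finset.mem_singleton]; grind
      rcases lt_or_gt_of_ne hij with h | h
      · simp [e1, e2, Finset.filter_insert, Finset.filter_singleton, h, h.not_gt]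
      · simp [e1, e2, Finset.filter_insert, Finset.filter_singleton, h, h.not_gt]
    · have h1 : i ∈ U → U.erase i ≠ {j} := fun hi h => hU (by
        rw [← Finset.insert_erase hi, h])
      have h2 : j ∈ U → U.erase j ≠ {i} := fun hi h => hU (by
        rw [← Finset.insert_erase hi, h, Finset.pair_comm])
      split_ifs <;> simp_all

/-- The linear form `∑ k, w k • a_{col k}`. -/
noncomputable def linForm {m : ℕ} (col : Fin m → ι) : (Fin m → ℂ) →ₗ[ℂ] Alg ι :=
  Fintype.linearCombination ℂ fun k => agen (col k)

lemma linForm_apply {m : ℕ} (col : Fin m → ι) (w : Fin m → ℂ) :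
    linForm col w = ∑ k, w k • agen (col k) := rfl

lemma linForm_mul_self {m : ℕ} (col : Fin m → ι) (w : Fin m → ℂ) :
    linForm col w * linForm col w = 0 := by
  have h : linForm col w * linForm col w = -(linForm col w * linForm col w) := by
    simp only [linForm_apply, Finset.sum_mul_sum]
    conv_lhs => rw [Finset.sum_comm]
    rw [← Finset.sum_neg_distrib]
    refine Finset.sum_congr rfl fun i _ => ?_
    rw [← Finset.sum_neg_distrib]
    refine Finset.sum_congr rfl fun j _ => ?_
    rw [smul_mul_smul_comm, smul_mul_smul_comm, agen_mul_agen, smul_neg, mul_comm]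
  have h2 : (2 : ℂ) • (linForm col w * linForm col w) = 0 := by
    rw [two_smul]
    exact add_eq_zero_iff_eq_neg.2 h
  exact (smul_eq_zero.1 h2).resolve_left two_ne_zero

/-- The product of `r` linear forms, as an alternating map. -/
noncomputable def prodForm {m : ℕ} (col : Fin m → ι) (r : ℕ) :
    (Fin m → ℂ) [⋀^Fin r]→ₗ[ℂ] Alg ι :=
  (ExteriorAlgebra.lift ℂ ⟨linForm col, linForm_mul_self col⟩).toLinearMap.compAlternatingMap
    (ExteriorAlgebra.ιMulti ℂ r)

lemma prodForm_apply {m r : ℕ} (col : Fin m → ι) (v : Fin r → Fin m → ℂ) :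
    prodForm col r v = (List.ofFn fun i => linForm col (v i)).prod := by
  simp [prodForm, ExteriorAlgebra.ιMulti_apply, map_list_prod, List.map_ofFn, Function.comp_def]

lemma prodForm_single {m r : ℕ} (col : Fin m → ι) (c : Fin r → Fin m) :
    prodForm col r (fun i => Pi.single (c i) 1) = genProdL ((List.ofFn c).map col) := by
  rw [prodForm_apply, genProdL_eq_prod]
  simp [linForm, List.map_ofFn, Function.comp_def]

lemma detColumns_ofFn {r m : ℕ} (A : Matrix (Fin r) (Fin m) ℂ) (c : Fin r → Fin m) :
    detColumns A (List.ofFn c) = (A.submatrix id c).det := by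
  unfold detColumns
  congr 1
  ext i j
  simp

lemma units_smul_eq (u : ℤˣ) (x : Alg ι) : u • x = ((u : ℤ) : ℂ) • x := by
  rw [Units.smul_def, Int.cast_smul_eq_zsmul]

/-- The product of a minor with the corresponding monomial does not depend on the order
in which the columns are listed. -/
lemma detColumns_smul_genProdL_perm {r m : ℕ} (A : Matrix (Fin r) (Fin m) ℂ) (col : Fin m → ι)
    (c : Fin r → Fin m) (σ : Equiv.Perm (Fin r)) :
    detColumns A (List.ofFn (c ∘ σ)) • genProdL ((List.ofFn (c ∘ σ)).map col)
      = detColumns A (List.ofFn c) • genProdL ((List.ofFn c).map col) := by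
  have h1 : detColumns A (List.ofFn (c ∘ σ)) =
      ((Equiv.Perm.sign σ : ℤ) : ℂ) * detColumns A (List.ofFn c) := by
    rw [detColumns_ofFn, detColumns_ofFn, ← Matrix.det_permute']
    rfl
  have h2 := (prodForm col r).map_perm (fun i => Pi.single (c i) 1) σ
  have h3 : genProdL ((List.ofFn (c ∘ σ)).map col) =
      ((Equiv.Perm.sign σ : ℤ) : ℂ) • genProdL ((List.ofFn c).map col) := by
    rw [prodForm_single] at h2
    have h4 := prodForm_single col (c ∘ σ)
    refine h4.symm.trans (h2.trans ?_)
    exact units_smul_eq (ι := ι) _ _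
  rw [h1, h3, smul_smul]
  congr 1
  rcases Int.units_eq_one_or (Equiv.Perm.sign σ) with h | h <;> simp [h]

lemma exists_perm_of_ofFn_perm {r : ℕ} {α : Type*} {c d : Fin r → α} (hc : Function.Injective c)
    (h : (List.ofFn d).Perm (List.ofFn c)) : ∃ σ : Equiv.Perm (Fin r), d = c ∘ σ := by
  have hd : Function.Injective d := by
    rw [← List.nodup_ofFn, h.nodup_iff, List.nodup_ofFn]
    exact hc
  have hm : ∀ i, ∃ j, c j = d i := fun i => by
    have := h.mem_iff (a := d i)
    simpa [List.mem_ofFn] using this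
  choose s hs using hm
  have hs' : Function.Injective s := fun i j hij => hd (by rw [← hs, ← hs, hij])
  exact ⟨Equiv.ofBijective s (Finite.injective_iff_bijective.1 hs'), funext fun i => (hs i).symm⟩

lemma detColumns_smul_genProdL_of_perm {r m : ℕ} (A : Matrix (Fin r) (Fin m) ℂ)
    (col : Fin m → ι) {l l' : List (Fin m)} (hl : l.Nodup) (hr : l.length = r) (h : l'.Perm l) :
    detColumns A l' • genProdL (l'.map col) = detColumns A l • genProdL (l.map col) := by
  subst hr
  have h' := h.length_eq
  have e : l = List.ofFn l.get := (List.ofFn_get l).symm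
  have e' : l' = List.ofFn fun i : Fin l.length => l'.get (i.cast h'.symm) := by
    refine List.ext_getElem (by simp [h']) fun i _ _ => by simp
  have h'' : (List.ofFn fun i : Fin l.length => l'.get (i.cast h'.symm)).Perm
      (List.ofFn l.get) := by
    rw [← e, ← e']
    exact h
  obtain ⟨σ, hσ⟩ := exists_perm_of_ofFn_perm (List.nodup_iff_injective_get.1 hl) h''
  rw [e', hσ, detColumns_smul_genProdL_perm, ← e]

lemma sum_alternating_apply {α : Type*} {r m : ℕ} (s : Finset α)
    (F : α → (Fin m → ℂ) [⋀^Fin r]→ₗ[ℂ] Alg ι) (v : Fin r → Fin m → ℂ) :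
    (∑ a ∈ s, F a) v = ∑ a ∈ s, F a v :=
  map_sum (AddMonoidHom.mk' (fun f : (Fin m → ℂ) [⋀^Fin r]→ₗ[ℂ] Alg ι => f v)
    fun _ _ => rfl) F s

/-- The generating function of a matrix is the product of the linear forms of its rows. -/
lemma genFunL_eq_prodForm {r m : ℕ} (A : Matrix (Fin r) (Fin m) ℂ) (col : Fin m → ι) :
    genFunL A col = prodForm col r fun i => A i := by
  let Φ : (Fin m → ℂ) [⋀^Fin r]→ₗ[ℂ] Alg ι :=
    ∑ C : Finset (Fin m), if h : C.card = r then
      ((LinearMap.toSpanSingleton ℂ (Alg ι) (genProdL (C.sort.map col))).compAlternatingMap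
        Matrix.detRowAlternating).compLinearMap
          (LinearMap.funLeft ℂ ℂ (C.orderEmbOfFin h)) else 0
  have hΦ : ∀ B : Matrix (Fin r) (Fin m) ℂ, (Φ fun i => B i) = genFunL B col := by
    intro B
    rw [sum_alternating_apply]
    refine Finset.sum_congr rfl fun C _ => ?_
    split_ifs with h
    · have : C.sort = List.ofFn (C.orderEmbOfFin h) := by
        rw [List.ofFn_eq_map, Finset.listMap_orderEmbOfFin_finRange]
      conv_rhs => rw [this, detColumns_ofFn, ← this]
      rfl
    · simp
      rfl
  rw [← hΦ]
  congr 1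
  refine Module.Basis.ext_alternating (Pi.basisFun ℂ (Fin m)) fun c hc => ?_
  let B : Matrix (Fin r) (Fin m) ℂ := fun i => Pi.single (c i) 1
  simp only [Pi.basisFun_apply]
  refine (hΦ B).trans ?_
  rw [prodForm_single]
  have hcard : (Finset.univ.image c).card = r := by
    rw [Finset.card_image_of_injective _ hc, Finset.card_univ, Fintype.card_fin]
  unfold genFunL
  rw [Finset.sum_eq_single (Finset.univ.image c)]
  · rw [if_pos hcard, detColumns_smul_genProdL_of_perm B col (l := List.ofFn c)
      (List.nodup_ofFn.2 hc) (by simp), detColumns_ofFn]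
    · have : B.submatrix id c = 1 := by
        ext i j
        rw [Matrix.submatrix_apply, Matrix.one_apply]
        simp [B, Pi.single_apply, hc.eq_iff, eq_comm]
      rw [this, Matrix.det_one, one_smul]
    · rw [List.perm_ext_iff_of_nodup (Finset.sort_nodup _ _) (List.nodup_ofFn.2 hc)]
      simp [List.mem_ofFn]
  · intro C _ hC
    split_ifs with h
    · have : ∃ i, c i ∉ C := by
        by_contra! hcon
        exact hC (Finset.eq_of_subset_of_card_le
          (Finset.image_subset_iff.2 fun i _ => hcon i) (by rw [h, hcard])).symm
      obtain ⟨i, hi⟩ := this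
      have e : C.sort = List.ofFn (C.orderEmbOfFin h) := by
        rw [List.ofFn_eq_map, Finset.listMap_orderEmbOfFin_finRange]
      rw [e, detColumns_ofFn, Matrix.det_eq_zero_of_row_eq_zero i, zero_smul]
      intro j
      have : C.orderEmbOfFin h j ≠ c i := fun hj => hi (hj ▸ C.orderEmbOfFin_mem h j)
      rw [Matrix.submatrix_apply]
      simp [B, this]
    · simp
  · simp

lemma berezin_gmul_gen {i : ι} {f : G ι} (hf : ∀ T, i ∈ T → f T = 0) :
    berezin i (gmul f (gen i)) = f := by
  funext T
  unfold berezin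
  split_ifs with h
  · rw [hf T h]
  · have hT : insert i T \ T = {i} := by
      ext x
      simp only [Finset.mem_sdiff, Finset.mem_insert, Finset.mem_singleton]
      grind
    rw [gmul_apply, Finset.sum_eq_single T, hT]
    · have : ((T ×ˢ ({i} : Finset ι)).filter fun p => p.2 < p.1).card
          = (T.filter fun j => i < j).card := by
        rw [Finset.product_singleton, Finset.filter_map, Finset.card_map]
        rfl
      rw [shuffleSign, this]
      simp only [gen, if_true, mul_one]
      rw [← mul_assoc, ← pow_add, Even.neg_one_pow ⟨_, rfl⟩, one_mul]
    · intro S hS hne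
      rw [Finset.mem_powerset] at hS
      by_cases hi : i ∈ S
      · simp [hf S hi]
      · have : insert i T \ S ≠ {i} := fun hSi => hne <| by
          ext x
          have := Finset.ext_iff.1 hSi x
          have := @hS x
          simp only [Finset.mem_sdiff, Finset.mem_insert, Finset.mem_singleton] at *
          grind
        simp [gen, this]
    · simp

lemma gmul_vanish {i : ι} {f g : G ι} (hf : ∀ T, i ∈ T → f T = 0) (hg : ∀ T, i ∈ T → g T = 0) :
    ∀ T, i ∈ T → gmul f g T = 0 := by
  intro T hT
  rw [gmul_apply]
  refine Finset.sum_eq_zero fun S _ => ?_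
  by_cases h : i ∈ S
  · simp [hf S h]
  · simp [hg (T \ S) (Finset.mem_sdiff.2 ⟨hT, h⟩)]

lemma genProdL_vanish {i : ι} {l : List ι} (h : i ∉ l) : ∀ T, i ∈ T → genProdL l T = 0 := by
  induction l with
  | nil =>
    intro T hT
    exact if_neg (Finset.ne_empty_of_mem hT)
  | cons j l ih =>
    rw [List.mem_cons, not_or] at h
    refine gmul_vanish (fun T hT => if_neg ?_) (ih h.2)
    rintro rfl
    exact h.1 (Finset.mem_singleton.1 hT)

lemma genProdL_append (l l' : List ι) :
    genProdL (l ++ l') = gmul (genProdL l) (genProdL l') := by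
  rw [genProdL_eq_prod, List.map_append, List.prod_append, ← genProdL_eq_prod,
    ← genProdL_eq_prod]
  rfl

lemma multiBerezin_genProdL_append {l l' : List ι} (h : (l ++ l').Nodup) :
    multiBerezin l' (genProdL (l ++ l')) = genProdL l := by
  induction l' using List.reverseRecOn with
  | nil => simp [multiBerezin]
  | append_singleton l' i ih =>
    rw [← List.append_assoc, List.nodup_append] at h
    have hi : i ∉ l ++ l' := fun hi => h.2.2 i hi i (by simp) rfl
    have h1 : genProdL [i] = gen i := gmul_gone _
    rw [← List.append_assoc, genProdL_append, h1, multiBerezin, List.foldr_append]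
    simp only [List.foldr_cons, List.foldr_nil]
    rw [berezin_gmul_gen (genProdL_vanish hi)]
    exact ih h.1

lemma berezin_zero (i : ι) : berezin i (0 : G ι) = 0 := by
  funext T
  simp [berezin]

lemma multiBerezin_vanish {l : List ι} {i : ι} {f : G ι} (hf : ∀ T, i ∈ T → f T = 0) :
    ∀ T, i ∈ T → multiBerezin l f T = 0 := by
  induction l with
  | nil => exact hf
  | cons j l ih =>
    intro T hT
    change berezin j (multiBerezin l f) T = 0
    simp [berezin, ih (insert j T) (Finset.mem_insert_of_mem hT)]

lemma multiBerezin_eq_zero {l : List ι} {i : ι} (hi : i ∈ l) {f : G ι}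
    (hf : ∀ T, i ∈ T → f T = 0) : multiBerezin l f = 0 := by
  induction l with
  | nil => simp at hi
  | cons j l ih =>
    change berezin j (multiBerezin l f) = 0
    rcases List.mem_cons.1 hi with rfl | hi
    · funext T
      simp [berezin, multiBerezin_vanish hf (insert i T) (Finset.mem_insert_self i T)]
    · rw [ih hi, berezin_zero]

/-- The Berezin integral as a linear map. -/
noncomputable def berezinₗ (i : ι) : G ι →ₗ[ℂ] G ι where
  toFun := berezin i
  map_add' f g := by
    funext T
    by_cases h : i ∈ T <;> simp [berezin, h, mul_add]
  map_smul' c f := by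
    funext T
    by_cases h : i ∈ T <;> simp [berezin, h, mul_left_comm]

/-- The iterated Berezin integral as a linear map. -/
noncomputable def multiBerezinₗ : List ι → G ι →ₗ[ℂ] G ι
  | [] => LinearMap.id
  | i :: l => berezinₗ i ∘ₗ multiBerezinₗ l

lemma multiBerezinₗ_apply (l : List ι) (f : G ι) : multiBerezinₗ l f = multiBerezin l f := by
  induction l with
  | nil => rfl
  | cons i l ih => exact congrArg (berezin i) ih

/-- Integrating a generating function over the generators of a set of columns makes
these columns inner. -/
theorem multiBerezin_genFunL {r m : ℕ} (A : Matrix (Fin r) (Fin m) ℂ) {col : Fin m → ι}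
    (hcol : Function.Injective col) (I : Finset (Fin m)) :
    multiBerezin ((I.sort (· ≤ ·)).map col) (genFunL A col) = genFunInnerL A col I := by
  rw [← multiBerezinₗ_apply]
  unfold genFunL genFunInnerL
  rw [map_sum]
  refine Finset.sum_congr rfl fun C _ => ?_
  by_cases hC : C.card = r
  swap
  · simp [hC]
  by_cases hI : I ⊆ C
  · rw [if_pos hC, if_pos ⟨hI, hC⟩]
    have hnd : ((C \ I).sort (· ≤ ·) ++ I.sort (· ≤ ·)).Nodup := by
      refine (Finset.sort_nodup _ _).append (Finset.sort_nodup _ _) fun x hx hx' => ?_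
      simp only [Finset.mem_sort, Finset.mem_sdiff] at hx hx'
      exact hx.2 hx'
    have hperm : ((C \ I).sort (· ≤ ·) ++ I.sort (· ≤ ·)).Perm (C.sort (· ≤ ·)) := by
      rw [List.perm_ext_iff_of_nodup hnd (Finset.sort_nodup _ _)]
      intro x
      have := @hI x
      simp only [List.mem_append, Finset.mem_sort, Finset.mem_sdiff]
      tauto
    rw [← detColumns_smul_genProdL_of_perm A col (Finset.sort_nodup _ _)
      (by rw [Finset.length_sort, hC]) hperm, map_smul, multiBerezinₗ_apply, List.map_append,
      multiBerezin_genProdL_append]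
    rw [← List.map_append]
    exact hnd.map hcol
  · rw [if_pos hC, if_neg fun h => hI h.1, map_smul, multiBerezinₗ_apply]
    obtain ⟨x, hxI, hxC⟩ := Finset.not_subset.1 hI
    rw [multiBerezin_eq_zero (i := col x), smul_zero, zero_smul]
    · exact List.mem_map_of_mem ((Finset.mem_sort _).2 hxI)
    · refine genProdL_vanish ?_
      rw [List.mem_map_of_injective hcol, Finset.mem_sort]
      exact hxC

/-- The product of the `n` linear forms of a block row `B`, whose block columns carry the
generator vectors of the given faces. -/
noncomputable def blockRowProd {c n : ℕ} (B : Fin c → Matrix (Fin n) (Fin n) ℂ)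
    (faces : Fin c → Fin 5 × Fin 5 × Fin 5) : Alg (FaceComp n) :=
  (List.ofFn fun i : Fin n => ∑ d, ∑ e, B d i e •
    agen (fc (faces d).1 (faces d).2.1 (faces d).2.2 e)).prod

lemma ofBlocks_finProdFinEquiv {b c n : ℕ} (B : Fin b → Fin c → Matrix (Fin n) (Fin n) ℂ)
    (p : Fin b × Fin n) (q : Fin c × Fin n) :
    ofBlocks B (finProdFinEquiv p) (finProdFinEquiv q) = B p.1 q.1 p.2 q.2 := by
  have hp := finProdFinEquiv.symm_apply_apply p
  have hq := finProdFinEquiv.symm_apply_apply q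
  change B (finProdFinEquiv.symm (finProdFinEquiv p)).1 (finProdFinEquiv.symm (finProdFinEquiv q)).1
    (finProdFinEquiv.symm (finProdFinEquiv p)).2 (finProdFinEquiv.symm (finProdFinEquiv q)).2 = _
  rw [hp, hq]

lemma colGen_finProdFinEquiv {c n : ℕ} (faces : Fin c → Fin 5 × Fin 5 × Fin 5)
    (q : Fin c × Fin n) :
    colGen faces (finProdFinEquiv q) = fc (faces q.1).1 (faces q.1).2.1 (faces q.1).2.2 q.2 := by
  have hq := finProdFinEquiv.symm_apply_apply q
  change fc (faces (finProdFinEquiv.symm (finProdFinEquiv q)).1).1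
    (faces (finProdFinEquiv.symm (finProdFinEquiv q)).1).2.1
    (faces (finProdFinEquiv.symm (finProdFinEquiv q)).1).2.2
    (finProdFinEquiv.symm (finProdFinEquiv q)).2 = _
  rw [hq]

lemma colGen_injective {c n : ℕ} {faces : Fin c → Fin 5 × Fin 5 × Fin 5}
    (h : Function.Injective faces) : Function.Injective (colGen (n := n) faces) := by
  intro x y hxy
  obtain ⟨p, rfl⟩ := finProdFinEquiv.surjective x
  obtain ⟨q, rfl⟩ := finProdFinEquiv.surjective y
  rw [colGen_finProdFinEquiv, colGen_finProdFinEquiv] at hxy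
  simp only [fc, EmbeddingLike.apply_eq_iff_eq, Prod.mk.injEq] at hxy
  congr 1
  exact Prod.ext (h (Prod.ext hxy.1.1 (Prod.ext hxy.1.2.1 hxy.1.2.2))) hxy.2

lemma genFunL_ofBlocks {b c n : ℕ} (B : Fin b → Fin c → Matrix (Fin n) (Fin n) ℂ)
    (faces : Fin c → Fin 5 × Fin 5 × Fin 5) :
    genFunL (ofBlocks B) (colGen faces)
      = (List.ofFn fun k => blockRowProd (B k) faces).prod := by
  rw [genFunL_eq_prodForm, prodForm_apply, List.ofFn_mul, List.prod_flatten, List.map_ofFn]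
  congr 2
  funext k
  rw [Function.comp_apply, blockRowProd]
  congr 2
  funext i
  have hk : (⟨k * n + i, by
      calc (k : ℕ) * n + i < (k + 1) * n := by rw [Nat.add_mul, Nat.one_mul]; omega
        _ ≤ b * n := Nat.mul_le_mul_right n k.isLt⟩ : Fin (b * n)) = finProdFinEquiv (k, i) :=
    Fin.ext (by simp [mul_comm, add_comm])
  rw [hk, linForm_apply, ← finProdFinEquiv.sum_comp, Fintype.sum_prod_type]
  simp only [ofBlocks_finProdFinEquiv, colGen_finProdFinEquiv]

lemma tetraWeight_eq {n : ℕ} (ζ : Fin 5 → Matrix (Fin n) (Fin n) ℂ) (i₁ i₂ i₃ i₄ : Fin 5) :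
    tetraWeight ζ i₁ i₂ i₃ i₄ =
      blockRowProd (tetraBlocks ζ i₁ i₂ i₃ i₄ 0) (tetraFaces i₁ i₂ i₃ i₄)
        * blockRowProd (tetraBlocks ζ i₁ i₂ i₃ i₄ 1) (tetraFaces i₁ i₂ i₃ i₄) := by
  have h := genFunL_ofBlocks (tetraBlocks ζ i₁ i₂ i₃ i₄) (tetraFaces i₁ i₂ i₃ i₄)
  simp only [List.ofFn_succ, List.ofFn_zero, List.prod_cons, List.prod_nil, mul_one] at h
  exact h

/-- Extending a block row by zero block columns does not change the product of its linear
forms. -/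
lemma blockRowProd_eq_of_extend {c c' n : ℕ} {B : Fin c → Matrix (Fin n) (Fin n) ℂ}
    {faces : Fin c → Fin 5 × Fin 5 × Fin 5} {B' : Fin c' → Matrix (Fin n) (Fin n) ℂ}
    {faces' : Fin c' → Fin 5 × Fin 5 × Fin 5} (s : Fin c → Fin c') (hs : Function.Injective s)
    (hfaces : ∀ d, faces' (s d) = faces d) (hB : ∀ d, B' (s d) = B d)
    (hB' : ∀ d, (∀ k, s k ≠ d) → B' d = 0) :
    blockRowProd B faces = blockRowProd B' faces' := by
  unfold blockRowProd
  congr 2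
  funext i
  refine Fintype.sum_of_injective s hs _ _ (fun d hd => ?_) fun d => ?_
  · simp [hB' d fun k hk => hd ⟨k, hk⟩]
  · rw [hfaces, hB]

lemma tetraWeight_eq_of_extend {b c n : ℕ} (ζ : Fin 5 → Matrix (Fin n) (Fin n) ℂ)
    {B : Fin b → Fin c → Matrix (Fin n) (Fin n) ℂ} {faces : Fin c → Fin 5 × Fin 5 × Fin 5}
    (ρ : Fin 2 → Fin b) (s : Fin 4 → Fin c) (i₁ i₂ i₃ i₄ : Fin 5)
    (hs : Function.Injective s) (hfaces : ∀ d, faces (s d) = tetraFaces i₁ i₂ i₃ i₄ d)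
    (hB : ∀ k d, B (ρ k) (s d) = tetraBlocks ζ i₁ i₂ i₃ i₄ k d)
    (hB' : ∀ k d, (∀ e, s e ≠ d) → B (ρ k) d = 0) :
    tetraWeight ζ i₁ i₂ i₃ i₄ =
      gmul (blockRowProd (B (ρ 0)) faces) (blockRowProd (B (ρ 1)) faces) := by
  rw [tetraWeight_eq, blockRowProd_eq_of_extend s hs hfaces (hB 0) (hB' 0),
    blockRowProd_eq_of_extend s hs hfaces (hB 1) (hB' 1)]
  rfl

lemma prod_ofFn_four (f : Fin 4 → Alg ι) :
    (List.ofFn f).prod = gmul (gmul (f 0) (f 1)) (gmul (f 2) (f 3)) := by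
  change _ = f 0 * f 1 * (f 2 * f 3)
  simp [List.ofFn_succ, mul_assoc]

lemma prod_ofFn_six (f : Fin 6 → Alg ι) :
    (List.ofFn f).prod =
      gmul (gmul (gmul (f 0) (f 1)) (gmul (f 2) (f 3))) (gmul (f 4) (f 5)) := by
  change _ = f 0 * f 1 * (f 2 * f 3) * (f 4 * f 5)
  simp [List.ofFn_succ, mul_assoc]

lemma gmul_tetraWeight_eq_genFunL {n : ℕ} (ζ : Fin 5 → Matrix (Fin n) (Fin n) ℂ) :
    gmul (tetraWeight ζ 0 1 2 3) (tetraWeight ζ 0 1 2 4)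
      = genFunL (Lmat ζ) (colGen LFaces) := by
  rw [Lmat, genFunL_ofBlocks, prod_ofFn_four,
    tetraWeight_eq_of_extend ζ (B := LBlocks ζ) (faces := LFaces)
      ![0, 1] ![0, 1, 3, 5] 0 1 2 3 (by decide) (by decide)
      (by intro k d; fin_cases k <;> fin_cases d <;> rfl)
      (by intro k d hd; fin_cases k <;> fin_cases d <;> first | rfl | exact absurd hd (by decide)),
    tetraWeight_eq_of_extend ζ (B := LBlocks ζ) (faces := LFaces)
      ![2, 3] ![0, 2, 4, 6] 0 1 2 4 (by decide) (by decide)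
      (by intro k d; fin_cases k <;> fin_cases d <;> rfl)
      (by intro k d hd; fin_cases k <;> fin_cases d <;> first | rfl | exact absurd hd (by decide))]
  rfl

lemma gmul_gmul_tetraWeight_eq_genFunL {n : ℕ} (ζ : Fin 5 → Matrix (Fin n) (Fin n) ℂ) :
    gmul (gmul (tetraWeight ζ 0 1 3 4) (tetraWeight ζ 1 2 3 4)) (tetraWeight ζ 0 2 3 4)
      = genFunL (Rmat ζ) (colGen RFaces) := by
  rw [Rmat, genFunL_ofBlocks, prod_ofFn_six,
    tetraWeight_eq_of_extend ζ (B := RBlocks ζ) (faces := RFaces)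
      ![0, 1] ![0, 1, 6, 7] 0 1 3 4 (by decide) (by decide)
      (by intro k d; fin_cases k <;> fin_cases d <;> rfl)
      (by intro k d hd; fin_cases k <;> fin_cases d <;> first | rfl | exact absurd hd (by decide)),
    tetraWeight_eq_of_extend ζ (B := RBlocks ζ) (faces := RFaces)
      ![2, 3] ![4, 5, 7, 8] 1 2 3 4 (by decide) (by decide)
      (by intro k d; fin_cases k <;> fin_cases d <;> rfl)
      (by intro k d hd; fin_cases k <;> fin_cases d <;> first | rfl | exact absurd hd (by decide)),
    tetraWeight_eq_of_extend ζ (B := RBlocks ζ) (faces := RFaces)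
      ![4, 5] ![2, 3, 6, 8] 0 2 3 4 (by decide) (by decide)
      (by intro k d; fin_cases k <;> fin_cases d <;> rfl)
      (by intro k d hd; fin_cases k <;> fin_cases d <;> first | rfl | exact absurd hd (by decide))]
  rfl

/-- The columns of the block column `d`, in increasing order. -/
def blockCols {c : ℕ} (n : ℕ) (d : Fin c) : List (Fin (c * n)) :=
  (List.finRange n).map fun e => finProdFinEquiv (d, e)

lemma pairwise_blockCols {c n : ℕ} (d : Fin c) : (blockCols n d).Pairwise (· < ·) := by
  rw [blockCols, List.pairwise_map]
  refine (List.pairwise_lt_finRange n).imp fun {a b} h => ?_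
  rw [Fin.lt_def] at h ⊢
  simp only [finProdFinEquiv_apply_val]
  omega

lemma mem_blockCols {c n : ℕ} {d : Fin c} {j : Fin (c * n)} :
    j ∈ blockCols n d ↔ n * d ≤ j ∧ (j : ℕ) < n * d + n := by
  simp only [blockCols, List.mem_map, List.mem_finRange, true_and]
  constructor
  · rintro ⟨e, rfl⟩
    simp only [finProdFinEquiv_apply_val]
    omega
  · rintro ⟨h1, h2⟩
    refine ⟨⟨j - n * d, by omega⟩, Fin.ext ?_⟩
    simp only [finProdFinEquiv_apply_val]
    omega

lemma sort_eq_of_pairwise_lt {m : ℕ} {I : Finset (Fin m)} {l : List (Fin m)}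
    (hl : l.Pairwise (· < ·)) (hmem : ∀ j, j ∈ I ↔ j ∈ l) : I.sort (· ≤ ·) = l := by
  have : I = l.toFinset := by
    ext j
    rw [hmem, List.mem_toFinset]
  rw [this, List.toFinset_sort _ (hl.imp fun h => h.ne)]
  exact hl.imp le_of_lt

lemma blockCols_map_colGen {c n : ℕ} (faces : Fin c → Fin 5 × Fin 5 × Fin 5) (d : Fin c) :
    (blockCols n d).map (colGen faces) = Da n (faces d).1 (faces d).2.1 (faces d).2.2 := by
  rw [blockCols, Da, List.map_map]
  exact List.map_congr_left fun e _ => colGen_finProdFinEquiv faces (d, e)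

lemma sort_LInner (n : ℕ) : (LInner n).sort (· ≤ ·) = blockCols n 0 := by
  refine sort_eq_of_pairwise_lt (pairwise_blockCols 0) fun j => ?_
  rw [mem_blockCols]
  simp [LInner]

lemma sort_RInner (n : ℕ) :
    (RInner n).sort (· ≤ ·) = blockCols n 6 ++ blockCols n 7 ++ blockCols n 8 := by
  have v6 : ((6 : Fin 9) : ℕ) = 6 := rfl
  have v7 : ((7 : Fin 9) : ℕ) = 7 := rfl
  have v8 : ((8 : Fin 9) : ℕ) = 8 := rfl
  refine sort_eq_of_pairwise_lt ?_ fun j => ?_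
  · rw [List.pairwise_append, List.pairwise_append]
    refine ⟨⟨pairwise_blockCols 6, pairwise_blockCols 7, ?_⟩, pairwise_blockCols 8, ?_⟩
    all_goals
      intro a ha b hb
      simp only [List.mem_append, mem_blockCols, v6, v7, v8] at ha hb
      rw [Fin.lt_def]
      omega
  · have := j.isLt
    simp only [List.mem_append, mem_blockCols, RInner, Finset.mem_filter, Finset.mem_univ,
      true_and, v6, v7, v8]
    omega

end Grassmann

/-- **Lemma 3 of the paper**: (i) the `n`-fold Berezin integral
`∫⋯∫ 𝐟_{1234} 𝐟_{1235} 𝒟a_{123}` equals the generating function, with the columns of the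
inner face `123` as inner columns, of the `4n × 7n` matrix `L` obtained by vertically
concatenating the zero-extended matrices `f₃^full` of the tetrahedra `1234` and `1235`
over the face list `123, 124, 125, 134, 135, 234, 235`; (ii) the `3n`-fold integral
`∫⋯∫ 𝐟_{1245} 𝐟_{2345} 𝐟_{1345} 𝒟a_{145} 𝒟a_{245} 𝒟a_{345}` equals the generating
function, with the columns of the inner faces `145, 245, 345` as inner columns, of the
`6n × 9n` matrix `R` obtained by vertically concatenating the zero-extended matrices
`f₃^full` of the tetrahedra `1245`, `2345`, `1345` over the face list
`124, 125, 134, 135, 234, 235, 145, 245, 345`. -/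
theorem pachner_integrals_eq_genFunInner (n : ℕ) (ζ : Fin 5 → Matrix (Fin n) (Fin n) ℂ)
    (hζ : ∀ i j : Fin 5, i ≠ j → IsUnit (ζ i - ζ j)) :
    multiBerezin (Da n 0 1 2)
        (gmul (tetraWeight ζ 0 1 2 3) (tetraWeight ζ 0 1 2 4))
      = genFunInnerL (Lmat ζ) (colGen LFaces) (LInner n)
    ∧ multiBerezin (Da n 0 3 4 ++ Da n 1 3 4 ++ Da n 2 3 4)
        (gmul (gmul (tetraWeight ζ 0 1 3 4) (tetraWeight ζ 1 2 3 4))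
          (tetraWeight ζ 0 2 3 4))
      = genFunInnerL (Rmat ζ) (colGen RFaces) (RInner n) := by
  rw [gmul_tetraWeight_eq_genFunL, gmul_gmul_tetraWeight_eq_genFunL]
  constructor
  · rw [← multiBerezin_genFunL _ (colGen_injective (by decide)), sort_LInner,
      blockCols_map_colGen]
    rfl
  · rw [← multiBerezin_genFunL _ (colGen_injective (by decide)), sort_RInner, List.map_append,
      List.map_append, blockCols_map_colGen, blockCols_map_colGen, blockCols_map_colGen]
    rfl
end

section
/- Let ζ_1,…,ζ_5 be n×n complex matrices with all pairwise differences invertible; let L (4n×7n) and R (6n×9n) be the vertically concatenated, zero-extended matrices f_3^{full} for the two tetrahedra 1234, 1235 and the three tetrahedra 1245, 2345, 1345 respectively, as in the Pachner move 2→3, with inner columns those of face 123 for L and of faces 145, 245, 345 for R, and boundary columns those of the six faces 124, 125, 134, 135, 234, 235 in both. Then for every set S of 3n boundary columns (the same set for L and for R): (det ζ_{23}/(det ζ_{34} det ζ_{35})) · det′(L|_{S∪ℐ_L}) = (1/det ζ_{45}) · det′(R|_{S∪ℐ_R}), where ℐ_L, ℐ_R are the inner column sets of L, R, and det′ is the determinant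 of the corresponding maximal square submatrix with its inner columns moved to the right, preserving the relative order within the inner columns and within the boundary columns. -/
/-- The boundary columns of `L` indexed by the common boundary-column index set
(`6` boundary faces of `n` columns each, in the common order `124,125,134,135,234,235`). -/
def bndL {n : ℕ} (b : Fin (6 * n)) : Fin (7 * n) :=
  ⟨n + (b : ℕ), by have := b.isLt; omega⟩

/-- The boundary columns of `R` indexed by the common boundary-column index set. -/
def bndR {n : ℕ} (b : Fin (6 * n)) : Fin (9 * n) :=
  Fin.castLE (by omega : 6 * n ≤ 9 * n) b

namespace Matrix

/-- Flattening block matrices is multiplicative, also for rectangular arrays of blocks. -/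
theorem comp_mul {I J K N R : Type*} [Fintype J] [Fintype N] [NonUnitalNonAssocSemiring R]
    (X : Matrix I J (Matrix N N R)) (Y : Matrix J K (Matrix N N R)) :
    comp I K N N R (X * Y) = comp I J N N R X * comp J K N N R Y := by
  ext
  simp [comp_apply, mul_apply, sum_apply, Fintype.sum_prod_type]

/-- The determinant of a block upper triangular matrix with blocks of equal size. -/
theorem det_comp_of_upperTriangular {m N R : Type*} [Fintype m] [LinearOrder m]
    [Fintype N] [DecidableEq N] [CommRing R] (U : Matrix m m (Matrix N N R))
    (hU : ∀ i j, j < i → U i j = 0) :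
    (comp m m N N R U).det = ∏ i, (U i i).det := by
  have h : BlockTriangular (comp m m N N R U) Prod.fst := fun i j hij => by
    simp [comp_apply, hU _ _ hij]
  rw [h.det_fintype]
  refine Finset.prod_congr rfl fun k _ => ?_
  let e : N ≃ {a : m × N // a.1 = k} :=
    { toFun := fun x => ⟨(k, x), rfl⟩
      invFun := fun a => a.1.2
      left_inv := fun _ => rfl
      right_inv := by rintro ⟨⟨_, _⟩, rfl⟩; rfl }
  rw [← det_submatrix_equiv_self e]
  rfl

/-- The determinant of a block lower triangular matrix with blocks of equal size. -/
theorem det_comp_of_lowerTriangular {m N R : Type*} [Fintype m] [LinearOrder m]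
    [Fintype N] [DecidableEq N] [CommRing R] (U : Matrix m m (Matrix N N R))
    (hU : ∀ i j, i < j → U i j = 0) :
    (comp m m N N R U).det = ∏ i, (U i i).det := by
  rw [← det_transpose, transpose_comp, det_comp_of_upperTriangular]
  · simp
  · intro i j hij
    simp [hU _ _ hij]

/-- Block elimination: adding `E` times the upper block row to the lower one, and then `F` times
the new lower block row to the upper one, clears the upper right block. -/
theorem det_fromBlocks_of_elimination {m k R : Type*} [Fintype m] [DecidableEq m] [Fintype k]
    [DecidableEq k] [CommRing R] (A : Matrix m m R) (B : Matrix m k R) (C : Matrix k m R)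
    (D : Matrix k k R) (E : Matrix k m R) (F : Matrix m k R) (h : B + F * (E * B + D) = 0) :
    (fromBlocks A B C D).det = (A + F * (E * A + C)).det * (E * B + D).det := by
  have key : fromBlocks 1 F 0 1 * (fromBlocks 1 0 E 1 * fromBlocks A B C D) =
      fromBlocks (A + F * (E * A + C)) 0 (E * A + C) (E * B + D) := by
    simp [fromBlocks_multiply, h]
  have hdet := congrArg det key
  rw [det_mul, det_mul, det_fromBlocks_zero₂₁, det_fromBlocks_zero₁₂,
    det_fromBlocks_zero₁₂] at hdet
  simpa using hdet

end Matrix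

open Matrix

theorem ofBlocks_finProdFinEquiv {b c n : ℕ} (B : Fin b → Fin c → Matrix (Fin n) (Fin n) ℂ)
    (i : Fin b × Fin n) (j : Fin c × Fin n) :
    ofBlocks B (finProdFinEquiv i) (finProdFinEquiv j) = B i.1 j.1 i.2 j.2 := by
  have hi := finProdFinEquiv.symm_apply_apply i
  have hj := finProdFinEquiv.symm_apply_apply j
  conv_rhs => rw [← hi, ← hj]
  rfl

/-- A minor of a block matrix on the columns `bnd S` followed by whole blocks of inner columns,
reduced by block elimination of the inner columns. -/
theorem detColumns_ofBlocks {m k p c n : ℕ}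
    (B : Fin (m + k) → Fin c → Matrix (Fin n) (Fin n) ℂ)
    (β : Fin p → Fin c) (ι : Fin k → Fin c)
    (bnd : Fin (p * n) → Fin (c * n)) (inn : Fin (k * n) → Fin (c * n))
    (hbnd : ∀ x, bnd (finProdFinEquiv x) = finProdFinEquiv (β x.1, x.2))
    (hinn : ∀ x, inn (finProdFinEquiv x) = finProdFinEquiv (ι x.1, x.2))
    (S : Finset (Fin (p * n))) (hS : S.card = m * n)
    (E : Matrix (Fin k) (Fin m) (Matrix (Fin n) (Fin n) ℂ))
    (F : Matrix (Fin m) (Fin k) (Matrix (Fin n) (Fin n) ℂ))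
    (M : Matrix (Fin m) (Fin p) (Matrix (Fin n) (Fin n) ℂ))
    (D : Matrix (Fin k) (Fin k) (Matrix (Fin n) (Fin n) ℂ))
    (A : Matrix (Fin m) (Fin p) (Matrix (Fin n) (Fin n) ℂ))
    (Ainn : Matrix (Fin m) (Fin k) (Matrix (Fin n) (Fin n) ℂ))
    (C : Matrix (Fin k) (Fin p) (Matrix (Fin n) (Fin n) ℂ))
    (Cinn : Matrix (Fin k) (Fin k) (Matrix (Fin n) (Fin n) ℂ))
    (hA : ∀ i j, B (Fin.castAdd k i) (β j) = A i j)
    (hA' : ∀ i j, B (Fin.castAdd k i) (ι j) = Ainn i j)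
    (hC : ∀ i j, B (Fin.natAdd m i) (β j) = C i j)
    (hC' : ∀ i j, B (Fin.natAdd m i) (ι j) = Cinn i j)
    (hM : A + F * (E * A + C) = M) (hD : E * Ainn + Cinn = D) (hF : Ainn + F * D = 0) :
    detColumns (ofBlocks B) (S.sort.map bnd ++ (List.finRange (k * n)).map inn) =
      ((comp _ _ _ _ ℂ M).submatrix id fun x =>
        finProdFinEquiv.symm (S.orderEmbOfFin hS (finProdFinEquiv x))).det *
      (comp _ _ _ _ ℂ D).det := by
  let g : Fin m × Fin n → Fin p × Fin n := fun x =>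
    finProdFinEquiv.symm (S.orderEmbOfFin hS (finProdFinEquiv x))
  let e : (Fin m × Fin n) ⊕ (Fin k × Fin n) ≃ Fin ((m + k) * n) :=
    (Equiv.sumProdDistrib _ _ _).symm.trans
      ((finSumFinEquiv.prodCongr (Equiv.refl _)).trans finProdFinEquiv)
  have hmat : (of fun i j : Fin ((m + k) * n) =>
      if hj : (j : ℕ) < (S.sort.map bnd ++ (List.finRange (k * n)).map inn).length then
        ofBlocks B i ((S.sort.map bnd ++ (List.finRange (k * n)).map inn).get ⟨j, hj⟩)
      else 0).submatrix e e =
      fromBlocks ((comp _ _ _ _ ℂ A).submatrix id g) (comp _ _ _ _ ℂ Ainn)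
        ((comp _ _ _ _ ℂ C).submatrix id g) (comp _ _ _ _ ℂ Cinn) := by
    have hlen : (S.sort.map bnd ++ (List.finRange (k * n)).map inn).length = (m + k) * n := by
      simp [hS, add_mul]
    have hcol : ∀ x hx, (S.sort.map bnd ++ (List.finRange (k * n)).map inn).get ⟨e (.inl x), hx⟩ =
        finProdFinEquiv (β (g x).1, (g x).2) := by
      intro x hx
      have hlt : ((e (.inl x) : Fin _) : ℕ) = (finProdFinEquiv x : Fin (m * n)) := rfl
      rw [← hbnd]
      simp only [g, Equiv.apply_symm_apply, Finset.orderEmbOfFin_apply, List.get_eq_getElem, hlt]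
      rw [List.getElem_append_left (by
        rw [List.length_map, Finset.length_sort, hS]; exact Fin.isLt _), List.getElem_map]
      rfl
    have hcol' : ∀ x hx, (S.sort.map bnd ++ (List.finRange (k * n)).map inn).get
        ⟨e (.inr x), hx⟩ = finProdFinEquiv (ι x.1, x.2) := by
      intro x hx
      have hlt : ((e (.inr x) : Fin _) : ℕ) = m * n + (finProdFinEquiv x : Fin (k * n)) := by
        simp [e]
        ring
      rw [← hinn]
      simp only [List.get_eq_getElem, hlt]
      rw [List.getElem_append_right (by simp [hS])]
      simp only [List.getElem_map, List.length_map, Finset.length_sort, hS, List.getElem_finRange,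
        Nat.add_sub_cancel_left]
      rfl
    ext i j
    have hj : ((e j : Fin _) : ℕ) < (S.sort.map bnd ++ (List.finRange (k * n)).map inn).length :=
      (e j).isLt.trans_eq hlen.symm
    rw [submatrix_apply, of_apply, dif_pos hj]
    rcases j with j | j
    · rw [hcol]
      rcases i with i | i
      · exact (ofBlocks_finProdFinEquiv ..).trans (congrFun₂ (hA _ _) _ _)
      · exact (ofBlocks_finProdFinEquiv ..).trans (congrFun₂ (hC _ _) _ _)
    · rw [hcol']
      rcases i with i | i
      · exact (ofBlocks_finProdFinEquiv ..).trans (congrFun₂ (hA' _ _) _ _)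
      · exact (ofBlocks_finProdFinEquiv ..).trans (congrFun₂ (hC' _ _) _ _)
  have hadd : ∀ {I J : Type} (X Y : Matrix I J (Matrix (Fin n) (Fin n) ℂ)),
      comp _ _ _ _ ℂ (X + Y) = comp _ _ _ _ ℂ X + comp _ _ _ _ ℂ Y := fun _ _ => rfl
  have hD' : comp _ _ _ _ ℂ E * comp _ _ _ _ ℂ Ainn + comp _ _ _ _ ℂ Cinn = comp _ _ _ _ ℂ D := by
    rw [← comp_mul, ← hadd, hD]
  rw [detColumns, ← det_submatrix_equiv_self e, hmat,
    det_fromBlocks_of_elimination _ _ _ _ (comp _ _ _ _ ℂ E) (comp _ _ _ _ ℂ F), hD', ← hM]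
  · congr 2
    rw [hadd, comp_mul, hadd, comp_mul]
    rfl
  · rw [hD', ← comp_mul, ← hadd, hF]
    rfl

theorem sort_image_of_strictMono {α β : Type*} [LinearOrder α] [LinearOrder β] {f : α → β}
    (hf : StrictMono f) (s : Finset α) : (s.image f).sort (· ≤ ·) = s.sort.map f := by
  have h : s.image f = s.map ⟨f, hf.injective⟩ := (Finset.map_eq_image ⟨f, hf.injective⟩ s).symm
  rw [h]
  exact (StrictMonoOn.map_finsetSort ⟨f, hf.injective⟩ s (hf.strictMonoOn _)).symm

theorem sort_LInner (n : ℕ) : (LInner n).sort (· ≤ ·) =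
    (List.finRange (1 * n)).map (Fin.castLE (by omega : 1 * n ≤ 7 * n)) := by
  rw [← Fin.sort_univ, ← sort_image_of_strictMono (Fin.strictMono_castLE _)]
  congr 1
  ext j
  simp only [LInner, Finset.mem_filter, Finset.mem_univ, true_and, Finset.mem_image]
  constructor
  · intro h
    exact ⟨⟨j, by omega⟩, rfl⟩
  · rintro ⟨i, rfl⟩
    simpa using i.isLt

/-- The inner columns of `R` indexed from `0`. -/
def innR {n : ℕ} (j : Fin (3 * n)) : Fin (9 * n) :=
  ⟨6 * n + (j : ℕ), by have := j.isLt; omega⟩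

theorem sort_RInner (n : ℕ) :
    (RInner n).sort (· ≤ ·) = (List.finRange (3 * n)).map innR := by
  have hmono : StrictMono (innR (n := n)) := fun i j hij =>
    Nat.add_lt_add_left (show (i : ℕ) < j from hij) _
  rw [← Fin.sort_univ, ← sort_image_of_strictMono hmono]
  congr 1
  ext j
  simp only [RInner, Finset.mem_filter, Finset.mem_univ, true_and, Finset.mem_image]
  constructor
  · intro h
    exact ⟨⟨j - 6 * n, by omega⟩, Fin.ext (by simp [innR]; omega)⟩
  · rintro ⟨i, rfl⟩
    simp [innR]

theorem bndL_finProdFinEquiv {n : ℕ} (x : Fin 6 × Fin n) :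
    bndL (finProdFinEquiv x) = (finProdFinEquiv (x.1.succ, x.2) : Fin (7 * n)) := by
  ext
  simp [bndL]
  ring

theorem bndR_finProdFinEquiv {n : ℕ} (x : Fin 6 × Fin n) :
    bndR (finProdFinEquiv x) = (finProdFinEquiv (Fin.castAdd 3 x.1, x.2) : Fin (9 * n)) := rfl

theorem innR_finProdFinEquiv {n : ℕ} (x : Fin 3 × Fin n) :
    innR (finProdFinEquiv x) = (finProdFinEquiv (Fin.natAdd 6 x.1, x.2) : Fin (9 * n)) := by
  ext
  simp [innR]
  ring

/-- The matrix `L` with its inner columns eliminated, in terms of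
`cInv = (ζ_{23}⁻¹ ζ_{31})⁻¹`, `q₃ = ζ_{24}⁻¹ ζ_{41}` and `q₄ = ζ_{25}⁻¹ ζ_{51}`. -/
def reducedL {A : Type*} [Ring A] (cInv q₃ q₄ : A) : Matrix (Fin 3) (Fin 6) A :=
  !![-1, cInv * q₄, 1, 0, 0, cInv;
    -q₃, q₄, 0, 0, -1, 1;
    0, cInv * q₄ - 1, 0, 1, 0, cInv]

/-- The matrix `R` with its inner columns eliminated, in terms of `q₃ = ζ_{24}⁻¹ ζ_{41}`,
`q₄ = ζ_{25}⁻¹ ζ_{51}`, `sᵢ = ζ_{3,i+1}⁻¹ ζ_{i+1,1}` and `tᵢ = ζ_{3,i+1}⁻¹ ζ_{i+1,2}`. -/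
def reducedR {A : Type*} [Ring A] (q₃ q₄ s₃ s₄ t₃ t₄ : A) : Matrix (Fin 3) (Fin 6) A :=
  !![0, 0, s₃, -s₄, -t₃, t₄;
    1, -1, -1, 1, 0, 0;
    q₃ - 1, 1 - q₄, 1, -1, 1, -1]

/-- The transition matrix from the reduced left-hand side to the reduced right-hand side. -/
def transition {A : Type*} [Ring A] (s₃ s₄ t₃ : A) : Matrix (Fin 3) (Fin 3) A :=
  !![s₃, t₃, -s₄; -1, 0, 1; 1, -1, -1]

theorem reducedR_eq_transition_mul {A : Type*} [Ring A] {cInv q₃ q₄ s₃ s₄ t₃ t₄ : A}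
    (h₃ : s₃ = -(t₃ * q₃)) (h₄ : s₄ = -(t₄ * q₄)) (h : (s₃ - s₄) * cInv = t₄ - t₃) :
    reducedR q₃ q₄ s₃ s₄ t₃ t₄ = transition s₃ s₄ t₃ * reducedL cInv q₃ q₄ := by
  have hsum : t₄ = (s₃ - s₄) * cInv + t₃ := by rw [h]; abel
  have h01 : s₃ * (cInv * q₄) + t₃ * q₄ - s₄ * (cInv * q₄ - 1) = 0 := by
    have : s₃ * (cInv * q₄) + t₃ * q₄ - s₄ * (cInv * q₄ - 1) =
        ((s₃ - s₄) * cInv + t₃) * q₄ + s₄ := by noncomm_ring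
    rw [this, ← hsum, h₄, add_neg_cancel]
  have h00 : 0 = -s₃ + -(t₃ * q₃) := by rw [h₃]; abel
  have h05 : t₄ = s₃ * cInv + (t₃ + -(s₄ * cInv)) := by rw [hsum]; noncomm_ring
  ext i j
  fin_cases i <;> fin_cases j <;>
    simp [reducedR, reducedL, transition, mul_apply, Fin.sum_univ_succ]
  · exact h00
  · rw [← h01]; abel
  · exact h05
  all_goals abel

theorem transition_eq_mul {A : Type*} [Ring A] {s sInv t tInv : A} (hs : sInv * s = 1)
    (hs' : s * sInv = 1) (ht : tInv * t = 1) (s₄ : A) :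
    transition s s₄ t =
      !![1, 0, 0; -sInv, 1, 0; sInv, -(tInv * s + 1), 1] *
      !![s, t, -s₄; 0, sInv * t, sInv * (s - s₄); 0, 0, tInv * (s - s₄)] := by
  have h : ∀ x, tInv * s * (sInv * x) = tInv * x := fun x => by
    rw [mul_assoc, ← mul_assoc s, hs', one_mul]
  ext i j
  fin_cases i <;> fin_cases j <;>
    simp [transition, mul_apply, Fin.sum_univ_succ, add_mul, mul_sub, h, hs, ht]
  all_goals abel

theorem eliminate_boundary_L {A : Type*} [Ring A] (cInv q₃ q₄ : A) :
    !![-1, 0, 1, 0, 0, 0; -q₃, 0, 0, 0, -1, 0; 0, -1, 0, 1, 0, 0] +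
      !![-cInv; -1; -cInv] * ((0 : Matrix (Fin 1) (Fin 3) A) *
        !![-1, 0, 1, 0, 0, 0; -q₃, 0, 0, 0, -1, 0; 0, -1, 0, 1, 0, 0] +
        !![0, -q₄, 0, 0, 0, -1]) = reducedL cInv q₃ q₄ := by
  ext i j
  fin_cases i <;> fin_cases j <;> simp [reducedL]
  abel

theorem eliminate_inner_L {A : Type*} [Ring A] {c cInv : A} (hc : cInv * c = 1) :
    !![1; c; 1] + !![-cInv; -1; -cInv] * !![c] = 0 := by
  ext i j
  fin_cases i <;> fin_cases j <;> simp [hc]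

theorem eliminate_boundary_R {A : Type*} [Ring A] (q₃ q₄ s₃ s₄ t₃ t₄ : A) :
    !![1, -1, 0, 0, 0, 0; q₃, -q₄, 0, 0, 0, 0; 0, 0, 0, 0, 1, -1] +
      (!![-1, 0, 1; 0, -1, 0; 0, 1, 0] : Matrix (Fin 3) (Fin 3) A) *
        ((!![1, 0, 0; -1, 1, 0; 0, 0, 0] : Matrix (Fin 3) (Fin 3) A) *
          !![1, -1, 0, 0, 0, 0; q₃, -q₄, 0, 0, 0, 0; 0, 0, 0, 0, 1, -1] +
          !![0, 0, 0, 0, t₃, -t₄; 0, 0, 1, -1, 0, 0; 0, 0, s₃, -s₄, 0, 0]) =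
      reducedR q₃ q₄ s₃ s₄ t₃ t₄ := by
  ext i j
  fin_cases i <;> fin_cases j <;> simp [reducedR]
  all_goals abel

theorem pivot_R {A : Type*} [Ring A] :
    (!![1, 0, 0; -1, 1, 0; 0, 0, 0] : Matrix (Fin 3) (Fin 3) A) *
        !![1, 0, 0; 0, -1, 0; 0, 1, 0] + !![0, 0, -1; 1, 0, 0; 0, 0, -1] =
      !![1, 0, -1; 0, -1, 0; 0, 0, -1] := by
  ext i j
  fin_cases i <;> fin_cases j <;> simp

theorem eliminate_inner_R {A : Type*} [Ring A] :
    (!![1, 0, 0; 0, -1, 0; 0, 1, 0] : Matrix (Fin 3) (Fin 3) A) +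
      !![-1, 0, 1; 0, -1, 0; 0, 1, 0] * !![1, 0, -1; 0, -1, 0; 0, 0, -1] = 0 := by
  ext i j
  fin_cases i <;> fin_cases j <;> simp

/-- An LU decomposition computes the determinant of the transition matrix. -/
theorem det_comp_transition {N R : Type*} [Fintype N] [DecidableEq N] [CommRing R]
    {s₃ s₄ t₃ : Matrix N N R} (hs : IsUnit s₃) (ht : IsUnit t₃) :
    (comp _ _ _ _ R (transition s₃ s₄ t₃)).det = (s₃ - s₄).det := by
  obtain ⟨s, rfl⟩ := hs
  obtain ⟨t, rfl⟩ := ht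
  set sInv : Matrix N N R := ↑s⁻¹
  set tInv : Matrix N N R := ↑t⁻¹
  have hLU : transition (s : Matrix N N R) s₄ t =
      !![1, 0, 0; -sInv, 1, 0; sInv, -(tInv * s + 1), 1] *
      !![(s : Matrix N N R), t, -s₄; 0, sInv * t, sInv * (s - s₄); 0, 0, tInv * (s - s₄)] := by
    exact transition_eq_mul s.inv_mul s.mul_inv t.inv_mul s₄
  rw [hLU, comp_mul, det_mul, det_comp_of_lowerTriangular, det_comp_of_upperTriangular]
  · have h1 : (s : Matrix N N R).det * sInv.det = 1 := by rw [← det_mul]; simp [sInv]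
    have h2 : (t : Matrix N N R).det * tInv.det = 1 := by rw [← det_mul]; simp [tInv]
    simp [Fin.prod_univ_succ, det_mul]
    linear_combination ((s : Matrix N N R) - s₄).det *
      ((t : Matrix N N R).det * tInv.det * h1 + h2)
  · intro i j hij
    fin_cases i <;> fin_cases j <;> first | rfl | exact absurd hij (by decide)
  · intro i j hij
    fin_cases i <;> fin_cases j <;> first | rfl | exact absurd hij (by decide)

theorem det_comp_pivot_R {N R : Type*} [Fintype N] [DecidableEq N] [CommRing R] :
    (comp _ _ _ _ R (!![1, 0, -1; 0, -1, 0; 0, 0, -1] :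
      Matrix (Fin 3) (Fin 3) (Matrix N N R))).det = 1 := by
  rw [det_comp_of_upperTriangular]
  · simp [Fin.prod_univ_succ, det_neg, ← mul_pow]
  · intro i j hij
    fin_cases i <;> fin_cases j <;> first | rfl | exact absurd hij (by decide)

/-- **The coefficientwise form of the matrix pentagon equation** (cf. the proof of
Theorem 3 of the paper): for every set `S` of `3n` boundary columns (the same for `L` and
for `R`),
`(det ζ_{23} / (det ζ_{34} det ζ_{35})) · det′(L|_{S ∪ ℐ_L})
  = (det ζ_{45})⁻¹ · det′(R|_{S ∪ ℐ_R})`,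
where `ℐ_L`, `ℐ_R` are the inner column sets (faces `123`, resp. `145, 245, 345`) and
`det′` is the determinant of the maximal square submatrix on the indicated columns with
the inner columns moved to the right, the relative order being preserved both within the
inner and within the boundary columns. -/
theorem pentagon_minors_proportional (n : ℕ) (ζ : Fin 5 → Matrix (Fin n) (Fin n) ℂ)
    (hζ : ∀ i j : Fin 5, i ≠ j → IsUnit (ζ i - ζ j))
    (S : Finset (Fin (6 * n))) (hS : S.card = 3 * n) :
    ((ζ 1 - ζ 2).det / ((ζ 2 - ζ 3).det * (ζ 2 - ζ 4).det)) *
        detColumns (Lmat ζ)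
          ((S.image bndL).sort (· ≤ ·) ++ (LInner n).sort (· ≤ ·))
      = ((ζ 3 - ζ 4).det)⁻¹ *
        detColumns (Rmat ζ)
          ((S.image bndR).sort (· ≤ ·) ++ (RInner n).sort (· ≤ ·)) := by
  have inv_mul' : ∀ i j, i ≠ j → (ζ i - ζ j)⁻¹ * (ζ i - ζ j) = 1 := fun i j h =>
    nonsing_inv_mul _ ((isUnit_iff_isUnit_det _).1 (hζ i j h))
  have mul_inv' : ∀ i j, i ≠ j → (ζ i - ζ j) * (ζ i - ζ j)⁻¹ = 1 := fun i j h =>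
    mul_nonsing_inv _ ((isUnit_iff_isUnit_det _).1 (hζ i j h))
  have det_ne : ∀ i j, i ≠ j → (ζ i - ζ j).det ≠ 0 := fun i j h =>
    ((isUnit_iff_isUnit_det _).1 (hζ i j h)).ne_zero
  have isUnit_inv : ∀ i j, i ≠ j → IsUnit (ζ i - ζ j)⁻¹ := fun i j h =>
    isUnit_nonsing_inv_iff.2 (hζ i j h)
  have hmonoL : StrictMono (bndL (n := n)) := fun i j hij =>
    Nat.add_lt_add_left (show (i : ℕ) < j from hij) _
  have hmonoR : StrictMono (bndR (n := n)) := Fin.strictMono_castLE (by omega)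
  rw [sort_image_of_strictMono hmonoL, sort_LInner,
    sort_image_of_strictMono hmonoR, sort_RInner]
  set c := (ζ 1 - ζ 2)⁻¹ * (ζ 2 - ζ 0) with hc
  set q₃ := (ζ 1 - ζ 3)⁻¹ * (ζ 3 - ζ 0) with hq₃
  set q₄ := (ζ 1 - ζ 4)⁻¹ * (ζ 4 - ζ 0) with hq₄
  set s₃ := (ζ 2 - ζ 3)⁻¹ * (ζ 3 - ζ 0) with hs₃
  set s₄ := (ζ 2 - ζ 4)⁻¹ * (ζ 4 - ζ 0) with hs₄
  set t₃ := (ζ 2 - ζ 3)⁻¹ * (ζ 3 - ζ 1) with ht₃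
  set t₄ := (ζ 2 - ζ 4)⁻¹ * (ζ 4 - ζ 1) with ht₄
  set cInv := (ζ 2 - ζ 0)⁻¹ * (ζ 1 - ζ 2) with hc'
  have hcc : cInv * c = 1 := by
    rw [hc', hc, mul_assoc, ← mul_assoc (ζ 1 - ζ 2), mul_inv' 1 2 (by decide), one_mul,
      inv_mul' 2 0 (by decide)]
  have hL := detColumns_ofBlocks (m := 3) (k := 1) (LBlocks ζ) Fin.succ (fun _ => 0) bndL
    (Fin.castLE (by omega : 1 * n ≤ 7 * n)) bndL_finProdFinEquiv
    (fun x => by ext; simp) S hS 0 !![-cInv; -1; -cInv] (reducedL cInv q₃ q₄) !![c]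
    !![-1, 0, 1, 0, 0, 0; -q₃, 0, 0, 0, -1, 0; 0, -1, 0, 1, 0, 0] !![1; c; 1]
    !![0, -q₄, 0, 0, 0, -1] !![c]
    (fun i j => by fin_cases i <;> fin_cases j <;> rfl)
    (fun i j => by fin_cases i <;> fin_cases j <;> rfl)
    (fun i j => by fin_cases i <;> fin_cases j <;> rfl)
    (fun i j => by fin_cases i <;> fin_cases j <;> rfl)
    (eliminate_boundary_L cInv q₃ q₄) (by simp) (eliminate_inner_L hcc)
  have hR := detColumns_ofBlocks (m := 3) (k := 3) (RBlocks ζ) (Fin.castAdd 3) (Fin.natAdd 6) bndR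
    innR bndR_finProdFinEquiv innR_finProdFinEquiv S hS
    !![1, 0, 0; -1, 1, 0; 0, 0, 0] !![-1, 0, 1; 0, -1, 0; 0, 1, 0]
    (reducedR q₃ q₄ s₃ s₄ t₃ t₄) !![1, 0, -1; 0, -1, 0; 0, 0, -1]
    !![1, -1, 0, 0, 0, 0; q₃, -q₄, 0, 0, 0, 0; 0, 0, 0, 0, 1, -1]
    !![1, 0, 0; 0, -1, 0; 0, 1, 0]
    !![0, 0, 0, 0, t₃, -t₄; 0, 0, 1, -1, 0, 0; 0, 0, s₃, -s₄, 0, 0]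
    !![0, 0, -1; 1, 0, 0; 0, 0, -1]
    (fun i j => by fin_cases i <;> fin_cases j <;> rfl)
    (fun i j => by fin_cases i <;> fin_cases j <;> rfl)
    (fun i j => by fin_cases i <;> fin_cases j <;> rfl)
    (fun i j => by fin_cases i <;> fin_cases j <;> rfl)
    (eliminate_boundary_R q₃ q₄ s₃ s₄ t₃ t₄) pivot_R eliminate_inner_R
  have inv_mul_sub : ∀ i j k, i ≠ j →
      (ζ i - ζ j)⁻¹ * (ζ j - ζ k) = (ζ i - ζ j)⁻¹ * (ζ i - ζ k) - 1 := fun i j k h => by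
    rw [← inv_mul' i j h, ← mul_sub]
    congr 1
    abel
  have hst : ∀ j, j ≠ 1 → (ζ 2 - ζ j)⁻¹ * (ζ j - ζ 0) =
      -((ζ 2 - ζ j)⁻¹ * (ζ j - ζ 1) * ((ζ 1 - ζ j)⁻¹ * (ζ j - ζ 0))) := fun j hj => by
    rw [mul_assoc, ← mul_assoc (ζ j - ζ 1), ← neg_sub (ζ 1) (ζ j), neg_mul,
      mul_inv' 1 j hj.symm, neg_mul,
      one_mul, mul_neg, neg_neg]
  have hinv : (ζ 2 - ζ 3)⁻¹ - (ζ 2 - ζ 4)⁻¹ = (ζ 2 - ζ 3)⁻¹ * (ζ 3 - ζ 4) * (ζ 2 - ζ 4)⁻¹ := by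
    rw [← sub_sub_sub_cancel_left (ζ 4) (ζ 3) (ζ 2), mul_sub, sub_mul, inv_mul' 2 3 (by decide),
      mul_assoc, mul_inv' 2 4 (by decide)]
    simp
  have hdiff : s₃ - s₄ = ((ζ 2 - ζ 3)⁻¹ - (ζ 2 - ζ 4)⁻¹) * (ζ 2 - ζ 0) := by
    rw [hs₃, hs₄, inv_mul_sub 2 3 0 (by decide), inv_mul_sub 2 4 0 (by decide), sub_mul]
    abel
  have htc : (s₃ - s₄) * cInv = t₄ - t₃ := by
    rw [hdiff, hc', mul_assoc, ← mul_assoc (ζ 2 - ζ 0), mul_inv' 2 0 (by decide), one_mul, ht₃,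
      ht₄, inv_mul_sub 2 3 1 (by decide), inv_mul_sub 2 4 1 (by decide),
      ← neg_sub (ζ 1) (ζ 2)]
    noncomm_ring
  have hU := reducedR_eq_transition_mul (cInv := cInv) (q₃ := q₃) (q₄ := q₄) (s₃ := s₃) (s₄ := s₄)
    (t₃ := t₃) (t₄ := t₄) (hst 3 (by decide)) (hst 4 (by decide)) htc
  have hdetU := det_comp_transition (s₃ := s₃) (s₄ := s₄) (t₃ := t₃)
    ((isUnit_inv 2 3 (by decide)).mul (hζ 3 0 (by decide)))
    ((isUnit_inv 2 3 (by decide)).mul (hζ 3 1 (by decide)))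
  have hDL : (comp _ _ _ _ ℂ !![c]).det = c.det := by
    rw [det_comp_of_upperTriangular _ (fun i j h => absurd h (by simp))]
    simp
  have hDR := det_comp_pivot_R (N := Fin n) (R := ℂ)
  unfold Lmat Rmat
  rw [show detColumns (ofBlocks (LBlocks ζ)) _ = _ from hL,
    show detColumns (ofBlocks (RBlocks ζ)) _ = _ from hR, hDL, hDR, hU, comp_mul]
  have hsub : ∀ (X : Matrix (Fin 3 × Fin n) (Fin 3 × Fin n) ℂ)
      (Y : Matrix (Fin 3 × Fin n) (Fin 6 × Fin n) ℂ) (g : Fin 3 × Fin n → Fin 6 × Fin n),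
      ((X * Y).submatrix id g).det = X.det * (Y.submatrix id g).det := fun X Y g => by
    rw [← det_mul]
    rfl
  rw [hsub, hdetU, hdiff, hinv, hc]
  have h12 := det_ne 1 2 (by decide)
  have h23 := det_ne 2 3 (by decide)
  have h24 := det_ne 2 4 (by decide)
  have h34 := det_ne 3 4 (by decide)
  simp only [det_mul, det_nonsing_inv, Ring.inverse_eq_inv']
  field_simp
end
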